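/- Let (Ω, F) be a measurable space, let v_1, …, v_n be binary capacities on (Ω, F), let C = {A ∈ F : A = ⋃_{i=1}^n A_i for some A_i ∈ F with v_i(A_i) = 0 for each i} and assume Ω ∉ C. Let X : Ω → ℝ be bounded and F-measurable, set x* = inf{x ∈ ℝ : {X > x} ∈ C}, and let φ : ℝ → ℝ be increasing and continuous. Then the inf-convolution of I_{v_1}, …, I_{v_n} at φ ∘ X equals φ(x*), i.e., inf{∑_{i=1}^n I_{v_i}(Y_i) : (Y_1,…,Y_n) is an allocation of φ ∘ X} = φ(inf{∑_{i=1}^n I_{v_i}(X_i) : (X_1,…,X_n) is an allocation of X}). Moreover, if (A_1*, …, A_n*) is a measurable partition of Ω with A_i* ∩ {X > x*} ∈ C_{v_i} for each i, then the allocation Y_i* = (φ∘X − φ(x*))·1_{A_i*} + φ(x*)/n of φ ∘ X attains this infimum. -/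

import Mathlib

open MeasureTheory Set

/-- A capacity on a measurable space: `w ∅ = 0`, `w Ω = 1`, and `w` is monotone
on measurable sets. -/
def IsCapacity {Ω : Type*} [MeasurableSpace Ω] (w : Set Ω → ℝ) : Prop :=
  w ∅ = 0 ∧ w Set.univ = 1 ∧
    ∀ ⦃A B : Set Ω⦄, MeasurableSet A → MeasurableSet B → A ⊆ B → w A ≤ w B

/-- A binary capacity takes only the values 0 and 1 on measurable sets. -/
def IsBinaryCapacity {Ω : Type*} [MeasurableSpace Ω] (w : Set Ω → ℝ) : Prop :=
  IsCapacity w ∧ ∀ A : Set Ω, MeasurableSet A → w A = 0 ∨ w A = 1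

/-- The Choquet quantile `I_v (X) = inf {x | v {ω | X ω ≥ x} = 0}`. -/
noncomputable def choquetQuantile {Ω : Type*} [MeasurableSpace Ω]
    (v : Set Ω → ℝ) (X : Ω → ℝ) : ℝ :=
  sInf {x : ℝ | v {ω | x ≤ X ω} = 0}

/-- The sets that are finite unions of measurable sets `A i`, each null for the capacity `v i`. -/
def unionNullSets {Ω ι : Type*} [MeasurableSpace Ω] (v : ι → Set Ω → ℝ) : Set (Set Ω) :=
  {A : Set Ω | ∃ As : ι → Set Ω,
    (∀ i, MeasurableSet (As i)) ∧ (∀ i, v i (As i) = 0) ∧ A = ⋃ i, As i}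

section Capacity

open Filter Topology

variable {Ω : Type*} [MeasurableSpace Ω]

theorem IsBinaryCapacity.null_of_subset {w : Set Ω → ℝ} (hw : IsBinaryCapacity w) {A B : Set Ω}
    (hA : MeasurableSet A) (hB : MeasurableSet B) (hAB : A ⊆ B) (hB0 : w B = 0) : w A = 0 := by
  have hle := hw.1.2.2 hA hB hAB
  rcases hw.2 A hA with h | h
  · exact h
  · linarith

theorem bddBelow_setOf_null_superlevel {w : Set Ω → ℝ} (hw : IsBinaryCapacity w) {Y : Ω → ℝ}
    {M : ℝ} (hM : ∀ ω, |Y ω| ≤ M) : BddBelow {x : ℝ | w {ω | x ≤ Y ω} = 0} := by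
  refine ⟨-M, fun x hx => ?_⟩
  by_contra! hlt
  have huniv : {ω | x ≤ Y ω} = univ :=
    eq_univ_of_forall fun ω => hlt.le.trans (abs_le.1 (hM ω)).1
  rw [mem_ofPred_eq, huniv, hw.1.2.1] at hx
  exact one_ne_zero hx

theorem nonempty_setOf_null_superlevel {w : Set Ω → ℝ} (hw : IsBinaryCapacity w) {Y : Ω → ℝ}
    {M : ℝ} (hM : ∀ ω, |Y ω| ≤ M) : {x : ℝ | w {ω | x ≤ Y ω} = 0}.Nonempty := by
  refine ⟨M + 1, ?_⟩
  have hempty : {ω | M + 1 ≤ Y ω} = ∅ := by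
    ext ω
    have := (abs_le.1 (hM ω)).2
    simp only [mem_ofPred_eq, mem_empty_iff_false, iff_false, not_le]
    linarith
  rw [mem_ofPred_eq, hempty, hw.1.1]

theorem null_superlevel_of_choquetQuantile_lt {w : Set Ω → ℝ} (hw : IsBinaryCapacity w)
    {Y : Ω → ℝ} (hY : Measurable Y) {M : ℝ} (hM : ∀ ω, |Y ω| ≤ M) {x : ℝ}
    (hx : choquetQuantile w Y < x) : w {ω | x ≤ Y ω} = 0 := by
  obtain ⟨y, hy, hyx⟩ := exists_lt_of_csInf_lt (nonempty_setOf_null_superlevel hw hM) hx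
  exact hw.null_of_subset (measurableSet_le measurable_const hY)
    (measurableSet_le measurable_const hY) (fun ω (hω : x ≤ Y ω) => hyx.le.trans hω) hy

theorem choquetQuantile_le_of_null_superlevel {w : Set Ω → ℝ} (hw : IsBinaryCapacity w)
    {Y : Ω → ℝ} {M : ℝ} (hM : ∀ ω, |Y ω| ≤ M) {c : ℝ}
    (hc : ∀ x, c < x → w {ω | x ≤ Y ω} = 0) : choquetQuantile w Y ≤ c :=
  le_of_forall_gt_imp_ge_of_dense fun x hx =>
    csInf_le (bddBelow_setOf_null_superlevel hw hM) (hc x hx)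

theorem mem_unionNullSets_of_subset_iUnion {ι : Type*} {v : ι → Set Ω → ℝ}
    (hv : ∀ i, IsBinaryCapacity (v i)) {A : Set Ω} (hA : MeasurableSet A) {As : ι → Set Ω}
    (hAs : ∀ i, MeasurableSet (As i)) (hnull : ∀ i, v i (As i) = 0) (hsub : A ⊆ ⋃ i, As i) :
    A ∈ unionNullSets v := by
  refine ⟨fun i => A ∩ As i, fun i => hA.inter (hAs i), fun i => ?_, ?_⟩
  · exact (hv i).null_of_subset (hA.inter (hAs i)) (hAs i) inter_subset_right (hnull i)
  · rw [← inter_iUnion, inter_eq_left.2 hsub]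

theorem bddBelow_setOf_superlevel_mem_unionNullSets {ι : Type*} {v : ι → Set Ω → ℝ}
    (huniv : univ ∉ unionNullSets v) {X : Ω → ℝ} {M : ℝ} (hM : ∀ ω, |X ω| ≤ M) :
    BddBelow {x : ℝ | {ω | x < X ω} ∈ unionNullSets v} := by
  refine ⟨-M, fun x hx => ?_⟩
  by_contra! hlt
  have : {ω | x < X ω} = univ :=
    eq_univ_of_forall fun ω => hlt.trans_le (abs_le.1 (hM ω)).1
  exact huniv (this ▸ hx)

theorem nonempty_setOf_superlevel_mem_unionNullSets {ι : Type*} {v : ι → Set Ω → ℝ}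
    (hv : ∀ i, IsBinaryCapacity (v i)) {X : Ω → ℝ} {M : ℝ} (hM : ∀ ω, |X ω| ≤ M) :
    {x : ℝ | {ω | x < X ω} ∈ unionNullSets v}.Nonempty := by
  refine ⟨M, fun _ => ∅, fun _ => MeasurableSet.empty, fun i => (hv i).1.1, ?_⟩
  ext ω
  simpa using (abs_le.1 (hM ω)).2

theorem exists_partition_of_mem_unionNullSets {n : ℕ} (hn : 0 < n) {v : Fin n → Set Ω → ℝ}
    (hv : ∀ i, IsBinaryCapacity (v i)) {A : Set Ω} (hA : MeasurableSet A)
    (hmem : A ∈ unionNullSets v) :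
    ∃ Bs : Fin n → Set Ω, (∀ i, MeasurableSet (Bs i)) ∧
      Pairwise (Function.onFun Disjoint Bs) ∧ (⋃ i, Bs i) = univ ∧
      ∀ i, v i (Bs i ∩ A) = 0 := by
  obtain ⟨As, hAs, hnull, rfl⟩ := hmem
  set Es : Fin n → Set Ω := fun i => if i = ⟨0, hn⟩ then As i ∪ (⋃ j, As j)ᶜ else As i with hEs
  have hEm : ∀ i, MeasurableSet (Es i) := fun i => by
    by_cases h : i = ⟨0, hn⟩
    · simp only [hEs, if_pos h]; exact (hAs i).union hA.compl
    · simp only [hEs, if_neg h]; exact hAs i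
  have hEA : ∀ i, Es i ∩ (⋃ j, As j) ⊆ As i := fun i ω hω => by
    by_cases h : i = ⟨0, hn⟩
    · have h1 := hω.1
      simp only [hEs, if_pos h] at h1
      exact h1.resolve_right fun h2 => h2 hω.2
    · have h1 := hω.1
      simp only [hEs, if_neg h] at h1
      exact h1
  have hsubE : ∀ i, As i ⊆ Es i := fun i => by
    by_cases h : i = ⟨0, hn⟩
    · simp only [hEs, if_pos h]; exact subset_union_left
    · simp only [hEs, if_neg h]; exact subset_rfl
  have hBm : ∀ i, MeasurableSet (disjointed Es i) := fun i =>
    disjointedRec (fun _ _ ht => ht.diff (hEm _)) (hEm i)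
  refine ⟨disjointed Es, hBm, disjoint_disjointed Es, ?_, fun i => ?_⟩
  · rw [iUnion_disjointed, eq_univ_iff_forall]
    intro ω
    by_cases h : ω ∈ ⋃ j, As j
    · obtain ⟨j, hj⟩ := mem_iUnion.1 h
      exact mem_iUnion.2 ⟨j, hsubE j hj⟩
    · refine mem_iUnion.2 ⟨⟨0, hn⟩, ?_⟩
      simp only [hEs, if_true]
      exact Or.inr h
  · exact (hv i).null_of_subset ((hBm i).inter hA) (hAs i)
      ((inter_subset_inter_left _ (disjointed_le Es i)).trans (hEA i)) (hnull i)

theorem abs_comp_le_of_monotone {α : Type*} {φ : ℝ → ℝ} (hφ : Monotone φ) {X : α → ℝ} {M : ℝ}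
    (hM : ∀ ω, |X ω| ≤ M) (ω : α) : |φ (X ω)| ≤ max |φ (-M)| |φ M| :=
  abs_le_max_abs_abs (hφ (abs_le.1 (hM ω)).1) (hφ (abs_le.1 (hM ω)).2)

/-- No allocation of `φ ∘ X` does better than `φ` of the quantile of `X` determined by
`unionNullSets v`. -/
theorem le_sum_choquetQuantile {n : ℕ} (hn : 0 < n) {v : Fin n → Set Ω → ℝ}
    (hv : ∀ i, IsBinaryCapacity (v i)) (huniv : univ ∉ unionNullSets v)
    {X : Ω → ℝ} (hX : Measurable X) {M : ℝ} (hM : ∀ ω, |X ω| ≤ M)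
    {φ : ℝ → ℝ} (hφ : Monotone φ) (hφc : Continuous φ) {Ys : Fin n → Ω → ℝ}
    (hY : ∀ i, Measurable (Ys i)) (hYb : ∀ i, ∃ M : ℝ, ∀ ω, |Ys i ω| ≤ M)
    (hsum : ∀ ω, ∑ i, Ys i ω = φ (X ω)) :
    φ (sInf {x : ℝ | {ω | x < X ω} ∈ unionNullSets v}) ≤
      ∑ i, choquetQuantile (v i) (Ys i) := by
  have hn' : (0 : ℝ) < n := Nat.cast_pos.2 hn
  set s := sInf {x : ℝ | {ω | x < X ω} ∈ unionNullSets v}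
  set S := ∑ i, choquetQuantile (v i) (Ys i) with hS
  by_contra! hlt
  obtain ⟨y, hSy, hys⟩ := exists_between hlt
  obtain ⟨t, hyt, hts⟩ : ∃ t, y < φ t ∧ t < s := by
    have h1 : ∀ᶠ t in 𝓝[<] s, y < φ t :=
      (hφc.continuousAt.eventually (lt_mem_nhds hys)).filter_mono nhdsWithin_le_nhds
    exact (h1.and self_mem_nhdsWithin).exists
  have hmem : {ω | t < X ω} ∈ unionNullSets v := by
    refine mem_unionNullSets_of_subset_iUnion hv (measurableSet_lt measurable_const hX)
      (As := fun i => {ω | choquetQuantile (v i) (Ys i) + (y - S) / n ≤ Ys i ω})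
      (fun i => measurableSet_le measurable_const (hY i)) (fun i => ?_) fun ω hω => ?_
    · obtain ⟨K, hK⟩ := hYb i
      have : 0 < (y - S) / n := div_pos (sub_pos.2 hSy) hn'
      exact null_superlevel_of_choquetQuantile_lt (hv i) (hY i) hK (by linarith)
    · by_contra hcon
      simp only [mem_iUnion, mem_ofPred_eq, not_exists, not_le] at hcon
      have h1 : ∑ i, Ys i ω ≤ ∑ i, (choquetQuantile (v i) (Ys i) + (y - S) / n) :=
        Finset.sum_le_sum fun i _ => (hcon i).le
      rw [Finset.sum_add_distrib, ← hS, Finset.sum_const, Finset.card_univ, Fintype.card_fin,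
        nsmul_eq_mul, mul_div_cancel₀ _ hn'.ne', hsum] at h1
      have h2 : φ t ≤ φ (X ω) := hφ (le_of_lt hω)
      linarith
  exact (csInf_le (bddBelow_setOf_superlevel_mem_unionNullSets huniv hM) hmem).not_gt hts

/-- The allocation of `φ ∘ X` associated with a partition whose pieces are null above the
level `t`. -/
theorem allocation_of_partition {n : ℕ} (hn : 0 < n) {v : Fin n → Set Ω → ℝ}
    (hv : ∀ i, IsBinaryCapacity (v i)) {X : Ω → ℝ} (hX : Measurable X) {M : ℝ}
    (hM : ∀ ω, |X ω| ≤ M) {φ : ℝ → ℝ} (hφ : Monotone φ) {t : ℝ} {As : Fin n → Set Ω}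
    (hAs : ∀ i, MeasurableSet (As i)) (hdisj : Pairwise (Function.onFun Disjoint As))
    (hcover : (⋃ i, As i) = univ) (hnull : ∀ i, v i (As i ∩ {ω | t < X ω}) = 0)
    {Ys : Fin n → Ω → ℝ}
    (hYs : Ys = fun i ω => (As i).indicator (fun ω' => φ (X ω') - φ t) ω + φ t / n) :
    (∀ i, Measurable (Ys i)) ∧ (∀ i, ∃ M : ℝ, ∀ ω, |Ys i ω| ≤ M) ∧
      (∀ ω, ∑ i, Ys i ω = φ (X ω)) ∧ ∑ i, choquetQuantile (v i) (Ys i) ≤ φ t := by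
  subst hYs
  have hn' : (n : ℝ) ≠ 0 := Nat.cast_ne_zero.2 hn.ne'
  have hmeas : ∀ i, Measurable
      fun ω => (As i).indicator (fun ω' => φ (X ω') - φ t) ω + φ t / n := fun i =>
    (((hφ.measurable.comp hX).sub_const _).indicator (hAs i)).add_const _
  have hbdd : ∀ i, ∀ ω, |(As i).indicator (fun ω' => φ (X ω') - φ t) ω + φ t / n| ≤
      (max |φ (-M)| |φ M| + |φ t|) + |φ t / n| := fun i ω => by
    refine (abs_add_le _ _).trans (add_le_add_left ?_ _)
    by_cases h : ω ∈ As i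
    · rw [indicator_of_mem h]
      exact (abs_sub _ _).trans (add_le_add_left (abs_comp_le_of_monotone hφ hM ω) _)
    · rw [indicator_of_notMem h, abs_zero]
      positivity
  refine ⟨hmeas, fun i => ⟨_, hbdd i⟩, fun ω => ?_, ?_⟩
  · obtain ⟨j, hj⟩ := mem_iUnion.1 (hcover ▸ mem_univ ω : ω ∈ ⋃ i, As i)
    rw [Finset.sum_add_distrib, Finset.sum_eq_single j, indicator_of_mem hj, Finset.sum_const,
      Finset.card_univ, Fintype.card_fin, nsmul_eq_mul, mul_div_cancel₀ _ hn', sub_add_cancel]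
    · exact fun i _ hij => indicator_of_notMem (disjoint_right.1 (hdisj hij) hj) _
    · simp
  · calc ∑ i, choquetQuantile (v i) _ ≤ ∑ _i : Fin n, φ t / n := Finset.sum_le_sum fun i _ => ?_
      _ = φ t := by
        rw [Finset.sum_const, Finset.card_univ, Fintype.card_fin, nsmul_eq_mul,
          mul_div_cancel₀ _ hn']
    refine choquetQuantile_le_of_null_superlevel (hv i) (hbdd i) fun x hx =>
      (hv i).null_of_subset (measurableSet_le measurable_const (hmeas i))
        ((hAs i).inter (measurableSet_lt measurable_const hX)) (fun ω hω => ?_) (hnull i)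
    rw [mem_ofPred_eq] at hω
    by_cases h : ω ∈ As i
    · rw [indicator_of_mem h] at hω
      exact ⟨h, hφ.reflect_lt (show φ t < φ (X ω) by linarith)⟩
    · rw [indicator_of_notMem h] at hω
      linarith

theorem sInf_sum_choquetQuantile_eq {n : ℕ} (hn : 0 < n) {v : Fin n → Set Ω → ℝ}
    (hv : ∀ i, IsBinaryCapacity (v i)) (huniv : univ ∉ unionNullSets v)
    {X : Ω → ℝ} (hX : Measurable X) {M : ℝ} (hM : ∀ ω, |X ω| ≤ M)
    {φ : ℝ → ℝ} (hφ : Monotone φ) (hφc : Continuous φ) :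
    sInf {y : ℝ | ∃ Ys : Fin n → Ω → ℝ,
        (∀ i, Measurable (Ys i)) ∧ (∀ i, ∃ M : ℝ, ∀ ω, |Ys i ω| ≤ M) ∧
        (∀ ω, ∑ i, Ys i ω = φ (X ω)) ∧
        y = ∑ i, choquetQuantile (v i) (Ys i)} =
      φ (sInf {x : ℝ | {ω | x < X ω} ∈ unionNullSets v}) := by
  set s := sInf {x : ℝ | {ω | x < X ω} ∈ unionNullSets v}
  set T := {y : ℝ | ∃ Ys : Fin n → Ω → ℝ,
        (∀ i, Measurable (Ys i)) ∧ (∀ i, ∃ M : ℝ, ∀ ω, |Ys i ω| ≤ M) ∧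
        (∀ ω, ∑ i, Ys i ω = φ (X ω)) ∧
        y = ∑ i, choquetQuantile (v i) (Ys i)}
  have hlower : ∀ y ∈ T, φ s ≤ y := by
    rintro y ⟨Ys, hY, hYb, hsum, rfl⟩
    exact le_sum_choquetQuantile hn hv huniv hX hM hφ hφc hY hYb hsum
  have hupper : ∀ t, s < t → ∃ y ∈ T, y ≤ φ t := fun t ht => by
    obtain ⟨u, ⟨As, hAs, hnull, hu⟩, hut⟩ :=
      exists_lt_of_csInf_lt (nonempty_setOf_superlevel_mem_unionNullSets hv hM) ht
    have hmt := measurableSet_lt (measurable_const (a := t)) hX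
    have hmem : {ω | t < X ω} ∈ unionNullSets v :=
      mem_unionNullSets_of_subset_iUnion hv hmt hAs hnull
        (hu ▸ fun ω (hω : t < X ω) => hut.trans hω)
    obtain ⟨Bs, hB, hdisj, hcover, hBnull⟩ := exists_partition_of_mem_unionNullSets hn hv hmt hmem
    obtain ⟨h1, h2, h3, h4⟩ := allocation_of_partition hn hv hX hM hφ hB hdisj hcover hBnull rfl
    exact ⟨_, ⟨_, h1, h2, h3, rfl⟩, h4⟩
  refine le_antisymm ?_ ?_
  · refine ge_of_tendsto (hφc.continuousAt.tendsto.mono_left nhdsWithin_le_nhds :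
      Tendsto φ (𝓝[>] s) (𝓝 (φ s))) ?_
    filter_upwards [self_mem_nhdsWithin] with t ht
    obtain ⟨y, hy, hyt⟩ := hupper t ht
    exact (csInf_le ⟨φ s, hlower⟩ hy).trans hyt
  · obtain ⟨y, hy, -⟩ := hupper (s + 1) (lt_add_one s)
    exact le_csInf ⟨y, hy⟩ hlower

end Capacity

/-- Invariance of the inf-convolution of Choquet quantiles under increasing continuous
transformations `φ`: the inf-convolution at `φ ∘ X` equals `φ(x*)`, which is `φ` of the
inf-convolution at `X`; and any measurable partition `(A_i*)` with
`A_i* ∩ {X > x*} ∈ C_{v_i}` yields the optimal allocation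
`Y_i* = (φ∘X − φ(x*))·1_{A_i*} + φ(x*)/n` of `φ ∘ X`. -/
theorem infConvolution_invariance {Ω : Type*} [MeasurableSpace Ω]
    (n : ℕ) (hn : 0 < n)
    (v : Fin n → Set Ω → ℝ) (hv : ∀ i, IsBinaryCapacity (v i))
    (C : Set (Set Ω))
    (hC : C = {A : Set Ω | ∃ As : Fin n → Set Ω,
      (∀ i, MeasurableSet (As i)) ∧ (∀ i, v i (As i) = 0) ∧ A = ⋃ i, As i})
    (huniv : (Set.univ : Set Ω) ∉ C)
    (X : Ω → ℝ) (hX : Measurable X) (hXb : ∃ M : ℝ, ∀ ω, |X ω| ≤ M)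
    (xstar : ℝ) (hxstar : xstar = sInf {x : ℝ | {ω | x < X ω} ∈ C})
    (φ : ℝ → ℝ) (hφmono : Monotone φ) (hφcont : Continuous φ) :
    sInf {y : ℝ | ∃ Ys : Fin n → Ω → ℝ,
        (∀ i, Measurable (Ys i)) ∧ (∀ i, ∃ M : ℝ, ∀ ω, |Ys i ω| ≤ M) ∧
        (∀ ω, ∑ i, Ys i ω = φ (X ω)) ∧
        y = ∑ i, choquetQuantile (v i) (Ys i)} = φ xstar ∧
    φ xstar = φ (sInf {y : ℝ | ∃ Xs : Fin n → Ω → ℝ,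
        (∀ i, Measurable (Xs i)) ∧ (∀ i, ∃ M : ℝ, ∀ ω, |Xs i ω| ≤ M) ∧
        (∀ ω, ∑ i, Xs i ω = X ω) ∧
        y = ∑ i, choquetQuantile (v i) (Xs i)}) ∧
    (∀ As : Fin n → Set Ω,
      (∀ i, MeasurableSet (As i)) →
      Pairwise (Function.onFun Disjoint As) →
      (⋃ i, As i) = Set.univ →
      (∀ i, v i (As i ∩ {ω | xstar < X ω}) = 0) →
      (∑ i, choquetQuantile (v i)
          (fun ω => (As i).indicator (fun ω' => φ (X ω') - φ xstar) ω + φ xstar / n))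
        = φ xstar) := by
  obtain ⟨M, hM⟩ := hXb
  have hC' : C = unionNullSets v := hC
  clear hC
  subst hC' hxstar
  refine ⟨sInf_sum_choquetQuantile_eq hn hv huniv hX hM hφmono hφcont, ?_, ?_⟩
  · exact congrArg φ
      (sInf_sum_choquetQuantile_eq hn hv huniv hX hM monotone_id continuous_id).symm
  · intro As hAs hdisj hcover hnull
    obtain ⟨h1, h2, h3, h4⟩ :=
      allocation_of_partition hn hv hX hM hφmono hAs hdisj hcover hnull rfl
    exact le_antisymm h4 (le_sum_choquetQuantile hn hv huniv hX hM hφmono hφcont h1 h2 h3)
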